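/- Transfer of a price expansion to an implied-volatility expansion: let v : [0,∞) → ℝ be measurable, locally integrable, positive and continuous at 0 with v(0) > 0, set v̄(θ) = (1/θ)∫₀^θ v(t) dt and s_θ = √(v̄(θ)). Fix S₀ > 0, z ∈ ℝ, α ∈ ℝ and H ∈ (0,1/2], set Δ(θ) = (e^{z√θ} − 1)/√θ. Suppose P : (0,θ₀) → ℝ satisfies, as θ → 0⁺, P(θ)/(S₀·√θ) = Δ(θ)·Φ(Δ(θ)/s_θ) + s_θ·φ(Δ(θ)/s_θ)·(1 + α·θ^H + (z/2)·√θ) + o(θ^H), and suppose σ_imp : (0,θ₀) → (0,∞) satisfies p_BS(S₀, S₀·e^{z√θ}, θ, σ_imp(θ)) = P(θ) for all θ ∈ (0,θ₀). Then σ_imp(θ) = s_θ·(1 + α·θ^H) + o(θ^H) as θ → 0⁺. -/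

import Mathlib

open MeasureTheory Real Filter

/-- The standard normal density. -/
noncomputable def stdNormalPDF (x : ℝ) : ℝ :=
  (Real.sqrt (2 * Real.pi))⁻¹ * Real.exp (-(x ^ 2) / 2)

/-- The standard normal cumulative distribution function. -/
noncomputable def stdNormalCDF (x : ℝ) : ℝ :=
  ∫ t in Set.Iic x, stdNormalPDF t

/-- `d₁ = log(S/K)/(σ√θ) + σ√θ/2`. -/
noncomputable def d1 (S K θ σ : ℝ) : ℝ :=
  Real.log (S / K) / (σ * Real.sqrt θ) + σ * Real.sqrt θ / 2

/-- `d₂ = d₁ − σ√θ`. -/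
noncomputable def d2 (S K θ σ : ℝ) : ℝ :=
  d1 S K θ σ - σ * Real.sqrt θ

/-- Black-Scholes call price `c_BS(S,K,θ,σ) = S·Φ(d₁) − K·Φ(d₂)`. -/
noncomputable def cBS (S K θ σ : ℝ) : ℝ :=
  S * stdNormalCDF (d1 S K θ σ) - K * stdNormalCDF (d2 S K θ σ)

/-- Black-Scholes put price `p_BS(S,K,θ,σ) = K·Φ(−d₂) − S·Φ(−d₁)`. -/
noncomputable def pBS (S K θ σ : ℝ) : ℝ :=
  K * stdNormalCDF (-(d2 S K θ σ)) - S * stdNormalCDF (-(d1 S K θ σ))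

open Topology Asymptotics

lemma stdNormalPDF_pos (x : ℝ) : 0 < stdNormalPDF x := by
  unfold stdNormalPDF; positivity

lemma hasDerivAt_stdNormalPDF (x : ℝ) :
    HasDerivAt stdNormalPDF (-x * stdNormalPDF x) x := by
  unfold stdNormalPDF
  have h : HasDerivAt (fun y : ℝ => -(y ^ 2) / 2) (-x) x :=
    ((hasDerivAt_pow 2 x).neg.div_const 2).congr_deriv (by simp; ring)
  exact (h.exp.const_mul (√(2 * π))⁻¹).congr_deriv (by ring)

lemma continuous_stdNormalPDF : Continuous stdNormalPDF := by
  unfold stdNormalPDF; fun_prop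

lemma integrable_stdNormalPDF : Integrable stdNormalPDF := by
  unfold stdNormalPDF
  convert (integrable_exp_neg_mul_sq (b := 1 / 2) (by norm_num)).const_mul (√(2 * π))⁻¹ using 4
  ring

lemma hasDerivAt_stdNormalCDF (x : ℝ) : HasDerivAt stdNormalCDF (stdNormalPDF x) x := by
  have h : stdNormalCDF = fun y => (∫ t in (0 : ℝ)..y, stdNormalPDF t) + stdNormalCDF 0 := by
    funext y
    have := intervalIntegral.integral_Iic_sub_Iic (μ := volume) (f := stdNormalPDF) (a := 0) (b := y)
      integrable_stdNormalPDF.integrableOn integrable_stdNormalPDF.integrableOn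
    simp only [stdNormalCDF]
    linarith
  rw [h]
  exact (continuous_stdNormalPDF.integral_hasStrictDerivAt 0 x).hasDerivAt.add_const _

lemma hasStrictDerivAt_stdNormalCDF (x : ℝ) :
    HasStrictDerivAt stdNormalCDF (stdNormalPDF x) x :=
  hasStrictDerivAt_of_hasDerivAt_of_continuousAt
    (Eventually.of_forall hasDerivAt_stdNormalCDF) continuous_stdNormalPDF.continuousAt

lemma hasStrictDerivAt_stdNormalPDF (x : ℝ) :
    HasStrictDerivAt stdNormalPDF (-x * stdNormalPDF x) x :=
  hasStrictDerivAt_of_hasDerivAt_of_continuousAt (f' := fun x => -x * stdNormalPDF x)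
    (Eventually.of_forall hasDerivAt_stdNormalPDF)
    (continuous_neg.mul continuous_stdNormalPDF).continuousAt

lemma HasStrictDerivAt.tendsto_sub_div {ι : Type*} {l : Filter ι} {f : ℝ → ℝ} {f' c k : ℝ}
    {a b w : ι → ℝ} (hf : HasStrictDerivAt f f' c) (ha : Tendsto a l (𝓝 c))
    (hb : Tendsto b l (𝓝 c)) (hw : ∀ᶠ i in l, 0 < w i)
    (hk : Tendsto (fun i => (a i - b i) / w i) l (𝓝 k)) :
    Tendsto (fun i => (f (a i) - f (b i)) / w i) l (𝓝 (f' * k)) := by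
  have h1 : (fun i => f (a i) - f (b i) - (a i - b i) * f') =o[l] fun i => a i - b i := by
    simpa [Function.comp_def] using hf.isLittleO.comp_tendsto (ha.prodMk_nhds hb)
  have h2 : (fun i => a i - b i) =O[l] w :=
    isBigO_of_div_tendsto_nhds (hw.mono fun i hi h => absurd h hi.ne') k hk
  have h3 := (h1.trans_isBigO h2).tendsto_div_nhds_zero.add (hk.const_mul f')
  rw [zero_add] at h3
  refine h3.congr fun i => ?_
  ring

/-- Second-order accuracy of the symmetric difference quotient, uniformly in the base point. -/
lemma tendsto_symm_sub_div_sq {ι : Type*} {l : Filter ι} {f f' : ℝ → ℝ} {f'' c : ℝ}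
    {m h : ι → ℝ} (hf : ∀ x, HasDerivAt f (f' x) x) (hf' : HasStrictDerivAt f' f'' c)
    (hm : Tendsto m l (𝓝 c)) (hh : Tendsto h l (𝓝 0)) (hpos : ∀ᶠ i in l, 0 < h i) :
    Tendsto (fun i => (f (m i + h i) - f (m i - h i) - 2 * h i * f' (m i)) / h i ^ 2) l
      (𝓝 0) := by
  have hex : ∀ i, ∃ ξ, 0 < h i → ξ ∈ Set.Ioo 0 (h i) ∧
      f (m i + h i) - f (m i - h i) - 2 * h i * f' (m i) =
        (f' (m i + ξ) + f' (m i - ξ) - 2 * f' (m i)) * h i := by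
    intro i
    by_cases hi : 0 < h i
    · have hd : ∀ x, HasDerivAt (fun x => f (m i + x) - f (m i - x) - 2 * x * f' (m i))
          (f' (m i + x) + f' (m i - x) - 2 * f' (m i)) x := by
        intro x
        have h1 : HasDerivAt (fun x => f (m i + x)) (f' (m i + x)) x :=
          (hf (m i + x)).comp_const_add (m i) x
        have h2 : HasDerivAt (fun x => f (m i - x)) (-f' (m i - x)) x :=
          (hf (m i - x)).comp_const_sub (m i) x
        have h3 : HasDerivAt (fun x => 2 * x * f' (m i)) (2 * f' (m i)) x := by
          simpa using ((hasDerivAt_id x).const_mul 2).mul_const (f' (m i))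
        exact ((h1.sub h2).sub h3).congr_deriv (by ring)
      obtain ⟨ξ, hξ, he⟩ := exists_hasDerivAt_eq_slope _ _ hi
        (fun x _ => (hd x).continuousAt.continuousWithinAt) (fun x _ => hd x)
      refine ⟨ξ, fun _ => ⟨hξ, ?_⟩⟩
      rw [he, sub_zero (h i), div_mul_cancel₀ _ hi.ne']
      simp
    · exact ⟨0, fun h => absurd h hi⟩
  choose ξ hξ using hex
  have hξ0 : Tendsto ξ l (𝓝 0) :=
    tendsto_of_tendsto_of_tendsto_of_le_of_le' tendsto_const_nhds hh
      (hpos.mono fun i hi => (hξ i hi).1.1.le) (hpos.mono fun i hi => (hξ i hi).1.2.le)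
  have hξh : ξ =O[l] h := IsBigO.of_bound 1 (hpos.mono fun i hi => by
    rw [Real.norm_of_nonneg hi.le, Real.norm_of_nonneg (hξ i hi).1.1.le, one_mul]
    exact (hξ i hi).1.2.le)
  have h1 : (fun i => f' (m i + ξ i) - f' (m i) - ξ i * f'') =o[l] ξ := by
    simpa [Function.comp_def] using
      hf'.isLittleO.comp_tendsto ((by simpa using hm.add hξ0 : Tendsto (fun i => m i + ξ i) l
        (𝓝 c)).prodMk_nhds hm)
  have h2 : (fun i => f' (m i - ξ i) - f' (m i) + ξ i * f'') =o[l] ξ := by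
    simpa [Function.comp_def] using
      hf'.isLittleO.comp_tendsto ((by simpa using hm.sub hξ0 : Tendsto (fun i => m i - ξ i) l
        (𝓝 c)).prodMk_nhds hm)
  refine ((h1.add h2).trans_isBigO hξh).tendsto_div_nhds_zero.congr' ?_
  filter_upwards [hpos] with i hi
  rw [(hξ i hi).2]
  field_simp
  ring

/-- The Black-Scholes put price with log-moneyness `z * w` and maturity `w ^ 2`, divided by
`S * w`. -/
noncomputable def normalizedPut (z w σ : ℝ) : ℝ :=
  (exp (z * w) * stdNormalCDF (z / σ + σ * w / 2) - stdNormalCDF (z / σ - σ * w / 2)) / w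

lemma pBS_div_eq_normalizedPut {S θ σ : ℝ} (z : ℝ) (hS : 0 < S) (hθ : 0 < θ) (hσ : 0 < σ) :
    pBS S (S * exp (z * √θ)) θ σ / (S * √θ) = normalizedPut z (√θ) σ := by
  have hw : 0 < √θ := Real.sqrt_pos.2 hθ
  have hlog : Real.log (S / (S * exp (z * √θ))) = -(z * √θ) := by
    rw [div_mul_cancel_left₀ hS.ne', Real.log_inv, Real.log_exp]
  have h1 : -d1 S (S * exp (z * √θ)) θ σ = z / σ - σ * √θ / 2 := by
    rw [d1, hlog]; field_simp; ring
  have h2 : -d2 S (S * exp (z * √θ)) θ σ = z / σ + σ * √θ / 2 := by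
    rw [d2, neg_sub, sub_eq_add_neg, h1]; ring
  rw [pBS, h1, h2, normalizedPut]
  field_simp

lemma hasDerivAt_normalizedPut (z : ℝ) {w σ : ℝ} (hw : 0 < w) (hσ : 0 < σ) :
    HasDerivAt (normalizedPut z w) (stdNormalPDF (z / σ - σ * w / 2)) σ := by
  have hz : HasDerivAt (fun σ : ℝ => z / σ) (-z / σ ^ 2) σ := by
    simpa [div_eq_mul_inv] using (hasDerivAt_inv hσ.ne').const_mul z
  have hl : HasDerivAt (fun σ : ℝ => σ * w / 2) (w / 2) σ := by
    simpa using ((hasDerivAt_id σ).mul_const w).div_const 2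
  have h1 := (hasDerivAt_stdNormalCDF (z / σ + σ * w / 2)).comp σ (hz.add hl)
  have h2 := (hasDerivAt_stdNormalCDF (z / σ - σ * w / 2)).comp σ (hz.sub hl)
  have hrefl : exp (z * w) * stdNormalPDF (z / σ + σ * w / 2) =
      stdNormalPDF (z / σ - σ * w / 2) := by
    rw [stdNormalPDF, stdNormalPDF, mul_left_comm, ← Real.exp_add]
    congr 2
    field_simp
    ring
  refine (((h1.const_mul (exp (z * w))).sub h2).div_const w).congr_deriv ?_
  rw [← mul_assoc, hrefl]
  field_simp
  ring

lemma strictMonoOn_normalizedPut (z : ℝ) {w : ℝ} (hw : 0 < w) :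
    StrictMonoOn (normalizedPut z w) (Set.Ioi 0) :=
  strictMonoOn_of_deriv_pos (convex_Ioi 0)
    (fun _ hσ => (hasDerivAt_normalizedPut z hw hσ).continuousAt.continuousWithinAt)
    fun σ hσ => by
      rw [interior_Ioi] at hσ
      rw [(hasDerivAt_normalizedPut z hw hσ).deriv]
      exact stdNormalPDF_pos _

lemma exists_normalizedPut_sub_eq (z : ℝ) {w a b : ℝ} (hw : 0 < w) (ha : 0 < a) (hb : 0 < b) :
    ∃ ξ ∈ Set.uIcc a b, normalizedPut z w a - normalizedPut z w b =
      stdNormalPDF (z / ξ - ξ * w / 2) * (a - b) := by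
  wlog hab : a < b generalizing a b
  · rcases (not_lt.1 hab).eq_or_lt with rfl | h
    · exact ⟨b, by simp, by simp⟩
    · obtain ⟨ξ, hξ, he⟩ := this hb ha h
      exact ⟨ξ, Set.uIcc_comm a b ▸ hξ, by linarith⟩
  obtain ⟨ξ, hξ, he⟩ := exists_hasDerivAt_eq_slope (normalizedPut z w) _ hab
    (fun x hx => (hasDerivAt_normalizedPut z hw
      (ha.trans_le hx.1)).continuousAt.continuousWithinAt)
    (fun x hx => hasDerivAt_normalizedPut z hw (ha.trans hx.1))
  refine ⟨ξ, Set.Icc_subset_uIcc ⟨hξ.1.le, hξ.2.le⟩, ?_⟩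
  rw [he]
  have : b - a ≠ 0 := (sub_pos.2 hab).ne'
  field_simp
  ring

lemma tendsto_normalizedPut_sub_div {ι : Type*} {l : Filter ι} (z : ℝ) {s₀ k : ℝ}
    {w a b r : ι → ℝ} (hs₀ : 0 < s₀) (hw : Tendsto w l (𝓝 0)) (hwpos : ∀ᶠ i in l, 0 < w i)
    (ha : Tendsto a l (𝓝 s₀)) (hb : Tendsto b l (𝓝 s₀))
    (hk : Tendsto (fun i => (a i - b i) / r i) l (𝓝 k)) :
    Tendsto (fun i => (normalizedPut z (w i) (a i) - normalizedPut z (w i) (b i)) / r i) l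
      (𝓝 (stdNormalPDF (z / s₀) * k)) := by
  have hex : ∀ i, ∃ ξ ∈ Set.uIcc (a i) (b i), 0 < w i → 0 < a i → 0 < b i →
      normalizedPut z (w i) (a i) - normalizedPut z (w i) (b i) =
        stdNormalPDF (z / ξ - ξ * w i / 2) * (a i - b i) := by
    intro i
    by_cases h : 0 < w i ∧ 0 < a i ∧ 0 < b i
    · obtain ⟨ξ, hξ, he⟩ := exists_normalizedPut_sub_eq z h.1 h.2.1 h.2.2
      exact ⟨ξ, hξ, fun _ _ _ => he⟩
    · exact ⟨a i, Set.left_mem_uIcc, fun h1 h2 h3 => absurd ⟨h1, h2, h3⟩ h⟩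
  choose ξ hξ he using hex
  have hξ0 : Tendsto ξ l (𝓝 s₀) :=
    tendsto_of_tendsto_of_tendsto_of_le_of_le (by simpa using ha.min hb)
      (by simpa using ha.max hb) (fun i => (hξ i).1) (fun i => (hξ i).2)
  have harg : Tendsto (fun i => z / ξ i - ξ i * w i / 2) l (𝓝 (z / s₀)) := by
    simpa using (tendsto_const_nhds (x := z)).div hξ0 hs₀.ne' |>.sub ((hξ0.mul hw).div_const 2)
  refine (((continuous_stdNormalPDF.tendsto _).comp harg).mul hk).congr' ?_
  filter_upwards [hwpos, ha.eventually_const_lt hs₀, hb.eventually_const_lt hs₀] with i h1 h2 h3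
  rw [he i h1 h2 h3, Function.comp_apply, mul_div_assoc (stdNormalPDF _)]

lemma tendsto_exp_slope_sub_div {ι : Type*} {l : Filter ι} (z : ℝ) {w : ι → ℝ}
    (hw : Tendsto w l (𝓝 0)) (hwpos : ∀ᶠ i in l, 0 < w i) :
    Tendsto (fun i => ((exp (z * w i) - 1) / w i - z) / w i) l (𝓝 (z ^ 2 / 2)) := by
  have hzw : Tendsto (fun i => z * w i) l (𝓝 0) := by simpa using hw.const_mul z
  have h1 : (fun i => exp (z * w i) - ∑ j ∈ Finset.range 3, (z * w i) ^ j / (j.factorial : ℝ))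
      =O[l] fun i => w i ^ 3 := by
    refine ((Real.exp_sub_sum_range_isBigO_pow 3).comp_tendsto hzw).trans ?_
    simp only [Function.comp_def, mul_pow]
    exact isBigO_const_mul_self _ _ _
  have h2 : (fun i => w i ^ 3) =o[l] fun i => w i ^ 2 :=
    (isLittleO_pow_pow (𝕜 := ℝ) (by norm_num : 2 < 3)).comp_tendsto hw
  have h3 := (h1.trans_isLittleO h2).tendsto_div_nhds_zero.add_const (z ^ 2 / 2)
  rw [zero_add] at h3
  refine h3.congr' ?_
  filter_upwards [hwpos] with i hi
  simp [Finset.sum_range_succ, Nat.factorial]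
  field_simp
  ring

/-- First-order expansion of the normalized put around the Bachelier price with strike slope
`(exp (z * w) - 1) / w`. -/
lemma tendsto_normalizedPut_sub_bachelier_div {ι : Type*} {l : Filter ι} (z : ℝ) {s₀ : ℝ}
    {w s : ι → ℝ} (hs₀ : 0 < s₀) (hw : Tendsto w l (𝓝 0)) (hwpos : ∀ᶠ i in l, 0 < w i)
    (hs : Tendsto s l (𝓝 s₀)) :
    Tendsto (fun i => (normalizedPut z (w i) (s i) -
      ((exp (z * w i) - 1) / w i * stdNormalCDF ((exp (z * w i) - 1) / w i / s i) +
        s i * stdNormalPDF ((exp (z * w i) - 1) / w i / s i) * (1 + z / 2 * w i))) / w i) l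
      (𝓝 0) := by
  set Δ : ι → ℝ := fun i => (exp (z * w i) - 1) / w i with hΔ
  have hspos : ∀ᶠ i in l, 0 < s i := hs.eventually_const_lt hs₀
  have hΔ1 : Tendsto (fun i => (Δ i - z) / w i) l (𝓝 (z ^ 2 / 2)) :=
    tendsto_exp_slope_sub_div z hw hwpos
  have hΔ0 : Tendsto Δ l (𝓝 z) := by
    have h := (hΔ1.mul hw).add_const z
    rw [mul_zero, zero_add] at h
    refine h.congr' ?_
    filter_upwards [hwpos] with i hi
    field_simp
    ring
  have hm : Tendsto (fun i => z / s i) l (𝓝 (z / s₀)) := tendsto_const_nhds.div hs hs₀.ne'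
  have hh : Tendsto (fun i => s i * w i / 2) l (𝓝 0) := by simpa using (hs.mul hw).div_const 2
  have hhpos : ∀ᶠ i in l, 0 < s i * w i / 2 := by
    filter_upwards [hwpos, hspos] with i h1 h2
    positivity
  have hp : Tendsto (fun i => z / s i + s i * w i / 2) l (𝓝 (z / s₀)) := by
    simpa using hm.add hh
  have hq : Tendsto (fun i => Δ i / s i) l (𝓝 (z / s₀)) := hΔ0.div hs hs₀.ne'
  have hpq : Tendsto (fun i => ((z / s i + s i * w i / 2) - Δ i / s i) / w i) l
      (𝓝 (s₀ / 2 - z ^ 2 / 2 / s₀)) := by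
    refine ((hs.div_const 2).sub (hΔ1.div hs hs₀.ne')).congr' ?_
    filter_upwards [hwpos, hspos] with i h1 h2
    simp only [Pi.div_apply]
    field_simp
    ring
  have hqm : Tendsto (fun i => (Δ i / s i - z / s i) / w i) l (𝓝 (z ^ 2 / 2 / s₀)) := by
    refine (hΔ1.div hs hs₀.ne').congr' ?_
    filter_upwards [hwpos, hspos] with i h1 h2
    simp only [Pi.div_apply]
    field_simp
  have hA := (hasStrictDerivAt_stdNormalCDF (z / s₀)).tendsto_sub_div hp hq hwpos hpq
  have hB := (hasStrictDerivAt_stdNormalPDF (z / s₀)).tendsto_sub_div hq hm hwpos hqm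
  have hC := tendsto_symm_sub_div_sq hasDerivAt_stdNormalCDF
    (hasStrictDerivAt_stdNormalPDF (z / s₀)) hm hh hhpos
  have hD := (continuous_stdNormalPDF.tendsto _).comp hq
  have key := (((hΔ0.mul hA).add (((hs.pow 2).div_const 4).mul hC)).sub (hs.mul hB)).sub
    ((hs.mul hD).mul_const (z / 2))
  have hlim : z * (stdNormalPDF (z / s₀) * (s₀ / 2 - z ^ 2 / 2 / s₀)) + s₀ ^ 2 / 4 * 0 -
      s₀ * (-(z / s₀) * stdNormalPDF (z / s₀) * (z ^ 2 / 2 / s₀)) -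
      s₀ * stdNormalPDF (z / s₀) * (z / 2) = 0 := by
    field_simp
    ring
  rw [hlim] at key
  refine key.congr' ?_
  filter_upwards [hwpos, hspos] with i h1 h2
  have hexp : exp (z * w i) = 1 + w i * Δ i := by
    simp only [hΔ]; field_simp; ring
  have hΔi : (exp (z * w i) - 1) / w i = Δ i := rfl
  rw [hΔi, normalizedPut, hexp, Function.comp_apply]
  generalize stdNormalCDF (Δ i / s i) = A, stdNormalPDF (Δ i / s i) = B,
    stdNormalCDF (z / s i + s i * w i / 2) = C, stdNormalCDF (z / s i - s i * w i / 2) = D,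
    stdNormalPDF (z / s i) = E
  field_simp
  ring

lemma tendsto_average_nhdsGT {v : ℝ → ℝ} (hv_meas : Measurable v)
    (hv_cont : ContinuousWithinAt v (Set.Ici 0) 0) :
    Tendsto (fun θ => (1 / θ) * ∫ t in (0 : ℝ)..θ, v t) (𝓝[>] 0) (𝓝 (v 0)) := by
  have h := intervalIntegral.integral_hasDerivWithinAt_right (f := v) (a := 0) (b := 0)
    (s := Set.Ici 0) (t := Set.Ioi 0) (by simp)
    (hv_meas.stronglyMeasurable.stronglyMeasurableAtFilter)
    (hv_cont.mono Set.Ioi_subset_Ici_self)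
  rw [hasDerivWithinAt_iff_tendsto_slope, Set.Ici_sdiff_left] at h
  refine h.congr fun θ => ?_
  simp [slope_def_field, div_eq_inv_mul]

/-- Small price errors force small volatility errors of the same order. -/
lemma isLittleO_vol_of_isLittleO_normalizedPut {ι : Type*} {l : Filter ι} (z : ℝ) {s₀ : ℝ}
    {w σ b r : ι → ℝ} (hs₀ : 0 < s₀) (hw : Tendsto w l (𝓝 0)) (hwpos : ∀ᶠ i in l, 0 < w i)
    (hr : Tendsto r l (𝓝 0)) (hrpos : ∀ᶠ i in l, 0 < r i) (hσ : ∀ᶠ i in l, 0 < σ i)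
    (hb : Tendsto b l (𝓝 s₀))
    (h : (fun i => normalizedPut z (w i) (σ i) - normalizedPut z (w i) (b i)) =o[l] r) :
    (fun i => σ i - b i) =o[l] r := by
  have hshift : ∀ ε : ℝ, Tendsto (fun i => b i + ε * r i) l (𝓝 s₀) := fun ε => by
    simpa using hb.add (hr.const_mul ε)
  have hdiff : ∀ ε : ℝ, Tendsto (fun i => (normalizedPut z (w i) (b i + ε * r i) -
      normalizedPut z (w i) (σ i)) / r i) l (𝓝 (stdNormalPDF (z / s₀) * ε)) := fun ε => by
    have h1 := tendsto_normalizedPut_sub_div z (k := ε) (r := r) hs₀ hw hwpos (hshift ε) hb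
      (tendsto_const_nhds.congr' (by
        filter_upwards [hrpos] with i hi
        field_simp
        ring))
    have h2 := h1.sub h.tendsto_div_nhds_zero
    rw [sub_zero] at h2
    exact h2.congr fun i => by ring
  refine IsLittleO.of_bound fun ε hε => ?_
  have hpos : 0 < stdNormalPDF (z / s₀) * ε := mul_pos (stdNormalPDF_pos _) hε
  have hneg : stdNormalPDF (z / s₀) * -ε < 0 := by linarith
  filter_upwards [hwpos, hrpos, hσ, (hshift ε).eventually_const_lt hs₀,
    (hshift (-ε)).eventually_const_lt hs₀, (hdiff ε).eventually_const_lt hpos,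
    (hdiff (-ε)).eventually_lt_const hneg] with i h1 h2 h3 h4 h5 h6 h7
  have hup := ((strictMonoOn_normalizedPut z h1).lt_iff_lt h3 h4).1
    (sub_pos.1 ((div_pos_iff_of_pos_right h2).1 h6))
  have hlo := ((strictMonoOn_normalizedPut z h1).lt_iff_lt h5 h3).1
    (sub_neg.1 (by simpa using (div_lt_iff₀ h2).1 h7))
  rw [Real.norm_eq_abs, Real.norm_of_nonneg h2.le, abs_le]
  constructor <;> linarith

/-- Transfer of a price expansion to an implied-volatility expansion: let `v` be
measurable, locally integrable, positive and continuous at `0` with `v 0 > 0`, set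
`v̄(θ) = (1/θ)∫₀^θ v` and `s(θ) = √(v̄(θ))`, `Δ(θ) = (e^{z√θ} − 1)/√θ`. If
`P(θ)/(S₀√θ) = Δ(θ)Φ(Δ(θ)/s(θ)) + s(θ)φ(Δ(θ)/s(θ))(1 + αθ^H + (z/2)√θ) + o(θ^H)`
as `θ → 0⁺`, and `σ_imp(θ) > 0` satisfies
`p_BS(S₀, S₀e^{z√θ}, θ, σ_imp(θ)) = P(θ)` on `(0,θ₀)`, then
`σ_imp(θ) = s(θ)(1 + αθ^H) + o(θ^H)` as `θ → 0⁺`. -/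
theorem implied_vol_expansion_from_price_expansion
    (v : ℝ → ℝ) (hv_meas : Measurable v)
    (hv_int : ∀ a : ℝ, 0 < a → IntervalIntegrable v MeasureTheory.volume 0 a)
    (hv_pos : ∀ t : ℝ, 0 ≤ t → 0 < v t)
    (hv_cont : ContinuousWithinAt v (Set.Ici 0) 0)
    (s : ℝ → ℝ)
    (hs : ∀ θ : ℝ, s θ = Real.sqrt ((1 / θ) * ∫ t in (0:ℝ)..θ, v t))
    (S₀ : ℝ) (hS₀ : 0 < S₀) (z α : ℝ)
    (H : ℝ) (hH : H ∈ Set.Ioc (0:ℝ) (1/2))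
    (θ₀ : ℝ) (hθ₀ : 0 < θ₀)
    (P : ℝ → ℝ) (σimp : ℝ → ℝ)
    (hσimp_pos : ∀ θ ∈ Set.Ioo (0:ℝ) θ₀, 0 < σimp θ)
    (hprice : ∀ θ ∈ Set.Ioo (0:ℝ) θ₀,
      pBS S₀ (S₀ * Real.exp (z * Real.sqrt θ)) θ (σimp θ) = P θ)
    (hexp : (fun θ : ℝ =>
        P θ / (S₀ * Real.sqrt θ)
          - ((Real.exp (z * Real.sqrt θ) - 1) / Real.sqrt θ
                * stdNormalCDF ((Real.exp (z * Real.sqrt θ) - 1) / Real.sqrt θ / s θ)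
              + s θ * stdNormalPDF ((Real.exp (z * Real.sqrt θ) - 1) / Real.sqrt θ / s θ)
                * (1 + α * θ ^ H + z / 2 * Real.sqrt θ)))
      =o[nhdsWithin 0 (Set.Ioi 0)] fun θ : ℝ => θ ^ H) :
    (fun θ : ℝ => σimp θ - s θ * (1 + α * θ ^ H))
      =o[nhdsWithin 0 (Set.Ioi 0)] fun θ : ℝ => θ ^ H := by
  have hs₀ : 0 < √(v 0) := Real.sqrt_pos.2 (hv_pos 0 le_rfl)
  have hθ : ∀ᶠ θ : ℝ in 𝓝[>] 0, 0 < θ := self_mem_nhdsWithin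
  have hw : Tendsto (fun θ : ℝ => √θ) (𝓝[>] 0) (𝓝 0) := by
    simpa using (Real.continuous_sqrt.tendsto 0).mono_left nhdsWithin_le_nhds
  have hwpos : ∀ᶠ θ : ℝ in 𝓝[>] 0, 0 < √θ := hθ.mono fun θ h => Real.sqrt_pos.2 h
  have hr : Tendsto (fun θ : ℝ => θ ^ H) (𝓝[>] 0) (𝓝 0) := by
    have := (Real.continuousAt_rpow_const 0 H (Or.inr hH.1.le)).tendsto
    rw [Real.zero_rpow hH.1.ne'] at this
    exact this.mono_left nhdsWithin_le_nhds
  have hrpos : ∀ᶠ θ : ℝ in 𝓝[>] 0, 0 < θ ^ H := hθ.mono fun θ h => Real.rpow_pos_of_pos h H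
  have hwr : (fun θ : ℝ => √θ) =O[𝓝[>] 0] fun θ : ℝ => θ ^ H := by
    refine IsBigO.of_bound 1 ?_
    filter_upwards [hθ, (eventually_le_nhds zero_lt_one).filter_mono nhdsWithin_le_nhds]
      with θ h0 h1
    rw [Real.norm_of_nonneg (Real.sqrt_nonneg θ),
      Real.norm_of_nonneg (Real.rpow_nonneg h0.le H), one_mul, Real.sqrt_eq_rpow]
    exact Real.rpow_le_rpow_of_exponent_ge h0 h1 hH.2
  have hs_lim : Tendsto s (𝓝[>] 0) (𝓝 √(v 0)) := by
    rw [funext hs]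
    exact (tendsto_average_nhdsGT hv_meas hv_cont).sqrt
  have hb : Tendsto (fun θ => s θ * (1 + α * θ ^ H)) (𝓝[>] 0) (𝓝 √(v 0)) := by
    simpa using hs_lim.mul ((hr.const_mul α).const_add 1)
  have hmem : ∀ᶠ θ : ℝ in 𝓝[>] 0, θ ∈ Set.Ioo 0 θ₀ := Ioo_mem_nhdsGT hθ₀
  refine isLittleO_vol_of_isLittleO_normalizedPut z hs₀ hw hwpos hr hrpos
    (hmem.mono hσimp_pos) hb ?_
  have hbase := (isLittleO_of_tendsto' (hwpos.mono fun θ h h0 => absurd h0 h.ne')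
    (tendsto_normalizedPut_sub_bachelier_div z hs₀ hw hwpos hs_lim)).trans_isBigO hwr
  have hshift := tendsto_normalizedPut_sub_div z (k := √(v 0) * α) (r := fun θ => θ ^ H) hs₀ hw
    hwpos hb hs_lim ((hs_lim.mul_const α).congr' (by
      filter_upwards [hrpos] with θ h
      field_simp
      ring))
  have hΔ : Tendsto (fun θ : ℝ => (exp (z * √θ) - 1) / √θ) (𝓝[>] 0) (𝓝 z) := by
    have h := ((tendsto_exp_slope_sub_div z hw hwpos).mul hw).add_const z
    rw [mul_zero, zero_add] at h
    refine h.congr' ?_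
    filter_upwards [hwpos] with θ h
    field_simp
    ring
  have hvega := ((hs_lim.mul ((continuous_stdNormalPDF.tendsto _).comp
    (hΔ.div hs_lim hs₀.ne'))).mul_const α).sub hshift
  rw [show √(v 0) * stdNormalPDF (z / √(v 0)) * α -
    stdNormalPDF (z / √(v 0)) * (√(v 0) * α) = 0 by ring] at hvega
  have hcorr := (isLittleO_one_iff ℝ).2 hvega |>.mul_isBigO
    (isBigO_refl (fun θ : ℝ => θ ^ H) (𝓝[>] 0))
  simp only [one_mul] at hcorr
  refine ((hexp.sub hbase).add hcorr).congr' ?_ EventuallyEq.rfl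
  filter_upwards [hmem, hrpos] with θ h hrθ
  rw [← hprice θ h, pBS_div_eq_normalizedPut z hS₀ h.1 (hσimp_pos θ h)]
  simp only [Function.comp_apply, Pi.div_apply, sub_mul, div_mul_cancel₀ _ hrθ.ne']
  ring
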